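/- Characterization of fairness for a bad: a symmetric measurable division rule φ : [0,∞)ⁿ → Δ(N) satisfies Fair Share for a bad (i.e., E_μ[φ_i(X)·X_i] ≤ 1/n for every normalized problem μ and every i) if and only if there exists a number θ with 0 ≤ θ ≤ 1 such that φ_i(x) ≤ min{1/n + (θ/(n−1))·(x̄/x_i − 1), 1} for every i ∈ N and every x ∈ [0,∞)ⁿ with x_i > 0, where x̄ = (1/n)∑_j x_j. -/

import Mathlib

open MeasureTheory
open scoped BigOperators ENNReal

noncomputable section

namespace PaperFD

/-- A vector of (dis)utilities lies in the positive orthant `[0,∞)ⁿ`. -/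
def NonnegVec {n : ℕ} (x : Fin n → ℝ) : Prop := ∀ i, 0 ≤ x i

/-- A division rule: a measurable map from `[0,∞)ⁿ` to the simplex `Δ(N)`. -/
def IsRule {n : ℕ} (φ : (Fin n → ℝ) → (Fin n → ℝ)) : Prop :=
  Measurable φ ∧ ∀ x, NonnegVec x → (∀ i, 0 ≤ φ x i) ∧ ∑ i, φ x i = 1

/-- Symmetry of a rule: permuting the agents permutes their shares.  Here
`x ∘ σ` is the profile whose `i`-th coordinate is `x (σ i)`. -/
def IsSymmetricRule {n : ℕ} (φ : (Fin n → ℝ) → (Fin n → ℝ)) : Prop :=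
  ∀ (σ : Equiv.Perm (Fin n)) (x : Fin n → ℝ), NonnegVec x → ∀ i, φ (x ∘ σ) i = φ x (σ i)

/-- A normalized problem: a Borel probability measure on `[0,∞)ⁿ` whose
coordinate functions are integrable with expectation `1`. -/
def IsNormalizedProblem {n : ℕ} (μ : Measure (Fin n → ℝ)) : Prop :=
  IsProbabilityMeasure μ ∧ (∀ᵐ x ∂μ, NonnegVec x) ∧
    ∀ i, Integrable (fun x => x i) μ ∧ ∫ x, x i ∂μ = 1

/-- Fair Share for a good: every agent's expected utility is at least `1/n`
in every normalized problem. -/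
def FairShareGood {n : ℕ} (φ : (Fin n → ℝ) → (Fin n → ℝ)) : Prop :=
  ∀ μ : Measure (Fin n → ℝ), IsNormalizedProblem μ →
    ∀ i, (1 : ℝ) / n ≤ ∫ x, φ x i * x i ∂μ

/-- Fair Share for a bad: every agent's expected disutility is at most `1/n`
in every normalized problem. -/
def FairShareBad {n : ℕ} (φ : (Fin n → ℝ) → (Fin n → ℝ)) : Prop :=
  ∀ μ : Measure (Fin n → ℝ), IsNormalizedProblem μ →
    ∀ i, ∫ x, φ x i * x i ∂μ ≤ (1 : ℝ) / n

/-- Domination for goods: `φ` generates at least as much welfare as `ψ` at every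
profile, and strictly more at some profile. -/
def DominatesGood {n : ℕ} (φ ψ : (Fin n → ℝ) → (Fin n → ℝ)) : Prop :=
  (∀ x, NonnegVec x → ∑ i, ψ x i * x i ≤ ∑ i, φ x i * x i) ∧
  (∃ x, NonnegVec x ∧ ∑ i, ψ x i * x i < ∑ i, φ x i * x i)

/-- Domination for bads: `φ` generates at most as much cost as `ψ` at every
profile, and strictly less at some profile. -/
def DominatesBad {n : ℕ} (φ ψ : (Fin n → ℝ) → (Fin n → ℝ)) : Prop :=
  (∀ x, NonnegVec x → ∑ i, φ x i * x i ≤ ∑ i, ψ x i * x i) ∧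
  (∃ x, NonnegVec x ∧ ∑ i, φ x i * x i < ∑ i, ψ x i * x i)

/-- The Top-Heavy rule `φ^θ` for a good: agents outside the argmax set `τ(x)`
receive `max{1/n + (θ/(n−1))(1 − x̄/x_i), 0}` (which is `0` when `x_i = 0`),
and the agents with the largest utility split the remaining probability
equally. -/
def topHeavy (n : ℕ) (θ : ℝ) (x : Fin n → ℝ) : Fin n → ℝ := fun i =>
  let lowShare : Fin n → ℝ := fun j =>
    if x j = 0 then 0
    else max ((1 : ℝ) / n + θ / ((n : ℝ) - 1) * (1 - ((∑ k, x k) / n) / x j)) 0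
  let τ : Finset (Fin n) := Finset.univ.filter fun j => ∀ k, x k ≤ x j
  if i ∈ τ then (1 - ∑ j ∈ τᶜ, lowShare j) / (τ.card : ℝ)
  else lowShare i

/-- The Proportional rule for a good. -/
def propGood (n : ℕ) (x : Fin n → ℝ) : Fin n → ℝ := fun i =>
  if (∑ j, x j) = 0 then 1 / n else x i / ∑ j, x j

/-- The Bottom-Heavy rule `φ¹` for a bad.  When all coordinates are positive,
`t̃` is the largest `t ∈ {0,…,n}` such that
`∑_{i : x_i ≤ x^{(t)}} (∑_{j≠i} x_j)/(n(n−1)x_i) ≤ 1`; the agents with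
`x_i ≤ x^{(t̃)}` receive that bound, the agents at the next order statistic
split the remainder equally, and all others get `0`.  When some coordinate is
zero, the agents with zero disutility split the bad equally. -/
def bottomHeavy (n : ℕ) (x : Fin n → ℝ) : Fin n → ℝ := fun i =>
  if ∀ j, 0 < x j then
    let w : Fin n → ℝ := fun j =>
      (∑ k ∈ Finset.univ.erase j, x k) / ((n : ℝ) * ((n : ℝ) - 1) * x j)
    let sorted : Fin n → ℝ := fun k => x (Tuple.sort x k)
    let low : ℕ → Finset (Fin n) := fun t =>
      Finset.univ.filter fun j => ∃ k : Fin n, (k : ℕ) < t ∧ x j ≤ sorted k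
    let tt : ℕ := Nat.findGreatest (fun t => ∑ j ∈ low t, w j ≤ 1) n
    if i ∈ low tt then w i
    else if htt : tt < n then
      if x i = sorted ⟨tt, htt⟩ then
        (1 - ∑ j ∈ low tt, w j) /
          ((Finset.univ.filter fun j => x j = sorted ⟨tt, htt⟩).card : ℝ)
      else 0
    else 0
  else if x i = 0 then ((Finset.univ.filter fun j : Fin n => x j = 0).card : ℝ)⁻¹
  else 0


/-- Fair Share for a bad, tested on finitely supported problems. -/
lemma FairShareBad.sum_le {n : ℕ} {φ : (Fin n → ℝ) → (Fin n → ℝ)} (hφ : FairShareBad φ)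
    {ι : Type*} [Fintype ι] {w : ι → ℝ} {p : ι → Fin n → ℝ} (hw : ∀ k, 0 ≤ w k)
    (hp : ∀ k, NonnegVec (p k)) (hw1 : ∑ k, w k = 1) (hp1 : ∀ j, ∑ k, w k * p k j = 1)
    (i : Fin n) : ∑ k, w k * (φ (p k) i * p k i) ≤ 1 / n := by
  set μ : Measure (Fin n → ℝ) := ∑ k, ENNReal.ofReal (w k) • Measure.dirac (p k) with hμ
  have hint (F : (Fin n → ℝ) → ℝ) (k : ι) :
      Integrable F (ENNReal.ofReal (w k) • Measure.dirac (p k)) :=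
    (integrable_dirac (by simp)).smul_measure ENNReal.ofReal_ne_top
  have hintegral (F : (Fin n → ℝ) → ℝ) : ∫ x, F x ∂μ = ∑ k, w k * F (p k) := by
    rw [hμ, integral_finsetSum_measure fun k _ => hint F k]
    simp [integral_smul_measure, ENNReal.toReal_ofReal, hw]
  have hprob : IsProbabilityMeasure μ := ⟨by
    simp [hμ, ← ENNReal.ofReal_sum_of_nonneg fun k _ => hw k, hw1]⟩
  have hae : ∀ᵐ x ∂μ, NonnegVec x := by
    rw [hμ, ae_iff, Measure.finsetSum_apply]
    simp [Measure.smul_apply, hp]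
  have := hφ μ ⟨hprob, hae, fun j =>
    ⟨integrable_finsetSum_measure.2 fun k _ => hint _ k, by rw [hintegral, hp1]⟩⟩ i
  rwa [hintegral] at this

/-- A symmetric rule shares equally at constant profiles. -/
lemma IsSymmetricRule.apply_const {n : ℕ} {φ : (Fin n → ℝ) → (Fin n → ℝ)}
    (hrule : IsRule φ) (hsym : IsSymmetricRule φ) {t : ℝ} (ht : 0 ≤ t) (i : Fin n) :
    φ (fun _ => t) i = 1 / n := by
  have hall (j : Fin n) : φ (fun _ => t) j = φ (fun _ => t) i := by
    simpa [Function.comp_def] using (hsym (Equiv.swap i j) (fun _ => t) (fun _ => ht) i).symm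
  have hsum := (hrule.2 (fun _ => t) fun _ => ht).2
  have hn : (n : ℝ) ≠ 0 := by
    have := i.pos
    positivity
  simp only [hall, Finset.sum_const, Finset.card_univ, Fintype.card_fin, nsmul_eq_mul] at hsum
  field_simp
  linarith

/-- Fair Share for a bad on finitely supported problems whose common mean `m` need not be `1`:
mixing with a constant profile normalizes them. -/
lemma FairShareBad.sum_le_of_common_mean {n : ℕ} {φ : (Fin n → ℝ) → (Fin n → ℝ)}
    (hφ : FairShareBad φ) (hrule : IsRule φ) (hsym : IsSymmetricRule φ)
    {ι : Type*} [Fintype ι] {w : ι → ℝ} {p : ι → Fin n → ℝ} {m : ℝ} (hw : ∀ k, 0 ≤ w k)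
    (hp : ∀ k, NonnegVec (p k)) (hm : ∀ j, ∑ k, w k * p k j = m) (i : Fin n) :
    ∑ k, w k * (φ (p k) i * p k i) ≤ m / n := by
  have hn : (0 : ℝ) < n := by exact_mod_cast i.pos
  set W := ∑ k, w k with hW
  have hW0 : 0 ≤ W := Finset.sum_nonneg fun k _ => hw k
  have hm0 : 0 ≤ m := hm i ▸ Finset.sum_nonneg fun k _ => mul_nonneg (hw k) (hp k i)
  set t := (1 + W) / (1 + m) with ht
  have ht0 : 0 ≤ t := by positivity
  have hmain := hφ.sum_le (ι := Option ι)
    (w := fun k => k.elim ((1 + m) / (1 + W + m)) fun k => w k / (1 + W + m))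
    (p := fun k => k.elim (fun _ => t) p)
    (by rintro (_ | k)
        · simp only [Option.elim]; positivity
        · have := hw k
          simp only [Option.elim]; positivity)
    (by rintro (_ | k)
        · exact fun _ => ht0
        · exact hp k)
    (by simp only [Fintype.sum_option, Option.elim, ← Finset.sum_div, ← hW]
        field_simp
        ring)
    (fun j => by
        simp only [Fintype.sum_option, Option.elim, div_mul_eq_mul_div, ← Finset.sum_div, hm, ht]
        field_simp) i
  simp only [Fintype.sum_option, Option.elim, div_mul_eq_mul_div, ← Finset.sum_div,
    hsym.apply_const hrule ht0] at hmain
  rw [ht] at hmain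
  field_simp at hmain ⊢
  linarith

/-- Averaging a profile over the permutations fixing agent `i` replaces all the other
coordinates by their mean. -/
lemma sum_perm_fixing_apply {n : ℕ} (x : Fin n → ℝ) {i j : Fin n} (hj : j ≠ i) :
    ((n : ℝ) - 1) * ∑ σ : {σ : Equiv.Perm (Fin n) // σ i = i}, x (σ.1 j) =
      Fintype.card {σ : Equiv.Perm (Fin n) // σ i = i} * (∑ k, x k - x i) := by
  have hswap (k : Fin n) (hk : k ≠ i) :
      ∑ σ : {σ : Equiv.Perm (Fin n) // σ i = i}, x (σ.1 k) =
        ∑ σ : {σ : Equiv.Perm (Fin n) // σ i = i}, x (σ.1 j) := by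
    have hfix : Equiv.swap j k i = i := Equiv.swap_apply_of_ne_of_ne hj.symm hk.symm
    have hinv : Function.Involutive
        fun σ : {σ : Equiv.Perm (Fin n) // σ i = i} =>
          (⟨σ.1 * Equiv.swap j k, by simp [hfix, σ.2]⟩ :
            {σ : Equiv.Perm (Fin n) // σ i = i}) := fun σ => by
      ext1
      simp [mul_assoc]
    exact Fintype.sum_bijective _ hinv.bijective _ _ fun σ => by simp
  have htotal : ∑ k, ∑ σ : {σ : Equiv.Perm (Fin n) // σ i = i}, x (σ.1 k) =
      Fintype.card {σ : Equiv.Perm (Fin n) // σ i = i} * ∑ k, x k := by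
    rw [Finset.sum_comm]
    simp [Equiv.sum_comp _ x]
  rw [← Finset.add_sum_erase _ _ (Finset.mem_univ i),
    Finset.sum_congr rfl fun k hk => hswap k (Finset.ne_of_mem_erase hk)] at htotal
  have hcard : ((n - 1 : ℕ) : ℝ) = (n : ℝ) - 1 := by
    rw [Nat.cast_sub i.pos, Nat.cast_one]
  have hfixed : ∑ σ : {σ : Equiv.Perm (Fin n) // σ i = i}, x (σ.1 i) =
      Fintype.card {σ : Equiv.Perm (Fin n) // σ i = i} * x i := by
    simp [fun σ : {σ : Equiv.Perm (Fin n) // σ i = i} => σ.2]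
  rw [hfixed] at htotal
  simp only [Finset.sum_const, Finset.card_erase_of_mem (Finset.mem_univ i), Finset.card_univ,
    Fintype.card_fin, nsmul_eq_mul, hcard] at htotal
  linarith

/-- For a symmetric rule, fairness towards agent `i` only sees the disutility of `i` and the
total disutility of a finitely supported problem. -/
lemma FairShareBad.sum_le_of_sum_eq {n : ℕ} (hn : 2 ≤ n) {φ : (Fin n → ℝ) → (Fin n → ℝ)}
    (hφ : FairShareBad φ) (hrule : IsRule φ) (hsym : IsSymmetricRule φ)
    {ι : Type*} [Fintype ι] {w : ι → ℝ} {p : ι → Fin n → ℝ} (hw : ∀ k, 0 ≤ w k)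
    (hp : ∀ k, NonnegVec (p k)) (i : Fin n)
    (h : ∑ k, w k * (∑ j, p k j - n * p k i) = 0) :
    ∑ k, w k * (φ (p k) i * p k i - p k i / n) ≤ 0 := by
  have hn1 : (0 : ℝ) < (n : ℝ) - 1 := by
    have : (2 : ℝ) ≤ n := by exact_mod_cast hn
    linarith
  set c := (Fintype.card {σ : Equiv.Perm (Fin n) // σ i = i} : ℝ) with hc
  have hc0 : 0 < c := by
    have : Nonempty {σ : Equiv.Perm (Fin n) // σ i = i} := ⟨⟨1, rfl⟩⟩
    exact Nat.cast_pos.2 Fintype.card_pos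
  have hmain := hφ.sum_le_of_common_mean hrule hsym
    (ι := ι × {σ : Equiv.Perm (Fin n) // σ i = i}) (w := fun k => w k.1)
    (p := fun k => p k.1 ∘ k.2.1) (m := c * ∑ k, w k * p k i) (fun k => hw k.1)
    (fun k j => hp k.1 _)
    (fun j => by
      simp only [Fintype.sum_prod_type, Function.comp_apply, ← Finset.mul_sum]
      by_cases hj : j = i
      · subst hj
        simp only [fun σ : {σ : Equiv.Perm (Fin n) // σ j = j} => σ.2, Finset.sum_const,
          Finset.card_univ, nsmul_eq_mul, ← hc, Finset.mul_sum]
        exact Finset.sum_congr rfl fun k _ => by ring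
      · apply mul_left_cancel₀ hn1.ne'
        have hzero : ∑ k, w k * (c * (∑ j, p k j - p k i)) =
            ((n : ℝ) - 1) * (c * ∑ k, w k * p k i) := by
          rw [← sub_eq_zero, ← mul_zero c, ← h]
          simp only [Finset.mul_sum, ← Finset.sum_sub_distrib]
          exact Finset.sum_congr rfl fun k _ => by ring
        rw [← hzero, Finset.mul_sum]
        exact Finset.sum_congr rfl fun k _ => by
          rw [mul_left_comm, sum_perm_fixing_apply (p k) hj]) i
  have hinner (k : ι) (σ : {σ : Equiv.Perm (Fin n) // σ i = i}) :
      φ (p k ∘ σ.1) i = φ (p k) i := by rw [hsym σ.1 (p k) (hp k) i, σ.2]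
  simp only [Fintype.sum_prod_type, hinner, Function.comp_apply, Finset.sum_const,
    fun σ : {σ : Equiv.Perm (Fin n) // σ i = i} => σ.2, Finset.card_univ, nsmul_eq_mul,
    ← hc, ← Finset.mul_sum, mul_div_assoc] at hmain
  have hle := le_of_mul_le_mul_left hmain hc0
  simp only [mul_sub, Finset.sum_sub_distrib, ← mul_div_assoc, ← Finset.sum_div]
  linarith

/-- Fair Share for a bad yields a linear bound on the disutility of a given agent. -/
lemma FairShareBad.exists_linear_bound {n : ℕ} (hn : 2 ≤ n) {φ : (Fin n → ℝ) → (Fin n → ℝ)}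
    (hφ : FairShareBad φ) (hrule : IsRule φ) (hsym : IsSymmetricRule φ) (i : Fin n) :
    ∃ b : ℝ, 0 ≤ b ∧ n * ((n : ℝ) - 1) * b ≤ 1 ∧ ∀ x, NonnegVec x →
      φ x i * x i ≤ x i / n + b * (∑ j, x j - n * x i) := by
  have hn2 : (2 : ℝ) ≤ n := by exact_mod_cast hn
  have hn1 : (0 : ℝ) < (n : ℝ) - 1 := by linarith
  set g : (Fin n → ℝ) → ℝ := fun x => φ x i * x i - x i / n with hg
  set h : (Fin n → ℝ) → ℝ := fun x => ∑ j, x j - n * x i with hh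
  have hpair (x y : Fin n → ℝ) (hx : NonnegVec x) (hy : NonnegVec y) (hx0 : 0 < h x)
      (hy0 : h y < 0) : g x / h x ≤ g y / h y := by
    have := hφ.sum_le_of_sum_eq hn hrule hsym (w := fun k : Bool => bif k then -h y else h x)
      (p := fun k => bif k then x else y) (by rintro (_ | _) <;> simp <;> linarith)
      (by rintro (_ | _) <;> assumption) i (by simp [hh]; ring)
    simp only [Fintype.sum_bool, cond_true, cond_false] at this
    rw [← neg_div_neg_eq (g y), div_le_div_iff₀ hx0 (neg_pos.2 hy0)]
    simp only [hg]
    linarith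
  have hnonpos (x : Fin n → ℝ) (hx : NonnegVec x) (hx0 : h x = 0) : g x ≤ 0 := by
    simpa [hg] using hφ.sum_le_of_sum_eq hn hrule hsym (w := fun _ : Unit => 1) (p := fun _ => x)
      (fun _ => zero_le_one) (fun _ => hx) i (by simpa [hh] using hx0)
  set e : Fin n → ℝ := Pi.single i 1 with he
  have he0 : NonnegVec e := fun j => by
    by_cases hj : j = i
    · subst hj; simp [he]
    · simp [he, hj]
  have hhe : h e = -((n : ℝ) - 1) := by simp [hh, he]
  set u : Fin n → ℝ := fun j => if j = i then 0 else 1 with hu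
  have hu0 : NonnegVec u := fun j => by simp only [hu]; split_ifs <;> norm_num
  have hhu : h u = (n : ℝ) - 1 := by
    have : u = 1 - e := by
      ext j
      by_cases hj : j = i
      · subst hj; simp [hu, he]
      · simp [hu, he, hj]
    simp [hh, this, he]
  set S : Set ℝ := {r | ∃ x, NonnegVec x ∧ 0 < h x ∧ r = g x / h x} with hS
  have hmem : (0 : ℝ) ∈ S := ⟨u, hu0, hhu ▸ hn1, by simp [hg, hu]⟩
  have hub (y : Fin n → ℝ) (hy : NonnegVec y) (hy0 : h y < 0) : g y / h y ∈ upperBounds S := by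
    rintro _ ⟨x, hx, hx0, rfl⟩
    exact hpair x y hx hy hx0 hy0
  have he1 : h e < 0 := by rw [hhe]; linarith
  have hbdd : BddAbove S := ⟨_, hub e he0 he1⟩
  refine ⟨sSup S, le_csSup hbdd hmem, ?_, fun x hx => ?_⟩
  · have hle := csSup_le ⟨0, hmem⟩ (hub e he0 he1)
    rw [hhe, div_neg, ← neg_div, le_div_iff₀ hn1] at hle
    have hφe := (hrule.2 e he0).1 i
    have hge : g e = φ e i - 1 / n := by simp [hg, he]
    have : sSup S * ((n : ℝ) - 1) ≤ 1 / n := by linarith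
    rw [le_div_iff₀ (by linarith)] at this
    linarith
  · suffices g x ≤ sSup S * h x by
      simp only [hg, hh] at this
      linarith
    rcases lt_trichotomy (h x) 0 with hx0 | hx0 | hx0
    · exact (le_div_iff_of_neg hx0).1 (csSup_le ⟨0, hmem⟩ (hub x hx hx0))
    · rw [hx0, mul_zero]
      exact hnonpos x hx hx0
    · exact (div_le_iff₀ hx0).1 (le_csSup hbdd ⟨x, hx, hx0, rfl⟩)

/-- Characterization of fairness for a bad (Proposition 3): a symmetric
measurable division rule `φ` satisfies Fair Share for a bad iff there is a
`θ ∈ [0,1]` with `φ_i(x) ≤ min{1/n + (θ/(n−1))(x̄/x_i − 1), 1}` for every agent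
`i` and every profile `x ∈ [0,∞)ⁿ` with `x_i > 0`, where `x̄ = (∑_j x_j)/n`. -/
theorem fair_share_characterization_bad
    (n : ℕ) (hn : 2 ≤ n) (φ : (Fin n → ℝ) → (Fin n → ℝ))
    (hrule : IsRule φ) (hsym : IsSymmetricRule φ) :
    FairShareBad φ ↔
      ∃ θ : ℝ, 0 ≤ θ ∧ θ ≤ 1 ∧
        ∀ x : Fin n → ℝ, NonnegVec x → ∀ i, 0 < x i →
          φ x i ≤ min ((1 : ℝ) / n + θ / ((n : ℝ) - 1) * (((∑ j, x j) / n) / x i - 1)) 1 := by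
  have hn2 : (2 : ℝ) ≤ n := by exact_mod_cast hn
  have hn0 : (0 : ℝ) < n := by linarith
  have hn1 : (0 : ℝ) < (n : ℝ) - 1 := by linarith
  have hshare (x : Fin n → ℝ) (hx : NonnegVec x) (i : Fin n) : φ x i ≤ 1 :=
    (hrule.2 x hx).2 ▸
      Finset.single_le_sum (fun j _ => (hrule.2 x hx).1 j) (Finset.mem_univ i)
  constructor
  · intro hφ
    let o : Fin n := ⟨0, by omega⟩
    obtain ⟨b, hb0, hb1, hb⟩ := hφ.exists_linear_bound hn hrule hsym o
    refine ⟨n * ((n : ℝ) - 1) * b, by positivity, hb1, fun x hx i hi =>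
      le_min ?_ (hshare x hx i)⟩
    have hbi := hb (x ∘ Equiv.swap o i) fun j => hx _
    rw [hsym _ x hx] at hbi
    simp only [Function.comp_apply, Equiv.swap_apply_left, Equiv.sum_comp _ x] at hbi
    rw [← le_div_iff₀ hi] at hbi
    refine hbi.trans_eq ?_
    field_simp
  · rintro ⟨θ, hθ0, -, hθ⟩ μ ⟨hprob, hae, hμ⟩ i
    have hmean : Integrable (fun x : Fin n → ℝ => (∑ j, x j) / n) μ :=
      (integrable_finsetSum _ fun j _ => (hμ j).1).div_const _
    have hintX : Integrable (fun x : Fin n → ℝ => x i / n) μ := (hμ i).1.div_const _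
    have hintD : Integrable
        (fun x : Fin n → ℝ => θ / ((n : ℝ) - 1) * ((∑ j, x j) / n - x i)) μ :=
      (hmean.sub (hμ i).1).const_mul _
    calc ∫ x, φ x i * x i ∂μ
        ≤ ∫ x, (x i / n + θ / ((n : ℝ) - 1) * ((∑ j, x j) / n - x i)) ∂μ := by
          refine integral_mono_of_nonneg ?_ (hintX.add hintD) ?_
          · filter_upwards [hae] with x hx
            exact mul_nonneg ((hrule.2 x hx).1 i) (hx i)
          · filter_upwards [hae] with x hx
            rcases (hx i).eq_or_lt with hi | hi
            · have : 0 ≤ ∑ j, x j := Finset.sum_nonneg fun j _ => hx j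
              simp only [← hi, mul_zero, zero_div, zero_add, sub_zero]
              positivity
            · refine (mul_le_mul_of_nonneg_right ((hθ x hx i hi).trans (min_le_left _ _))
                hi.le).trans_eq ?_
              field_simp
      _ = 1 / n := by
          rw [integral_add hintX hintD, integral_const_mul, integral_sub hmean (hμ i).1,
            integral_div, integral_div, integral_finsetSum _ fun j _ => (hμ j).1]
          simp [fun j => (hμ j).2, hn0.ne']

end PaperFD
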